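/- Fix n ≥ 1 and integers 1 ≤ K ≤ K' ≤ n with K, K' both of the same parity as n. Consider the golf model on Z/nZ with no neutral vertices, i.e. with parameters (n_b, n_t) = ((n−K)/2, (n+K)/2), resp. (n_b', n_t') = ((n−K')/2, (n+K')/2), and any p ∈ (0,1). Then the largest block size is stochastically non-increasing in the number of remaining holes: for every t ≥ 0, P^{(n,K')}(max_i Δ_i TL ≥ t) ≤ P^{(n,K)}(max_i Δ_i TL ≥ t). -/

import Mathlib

open Finset MeasureTheory Filter Asymptotics
open scoped Classical

namespace Golf

/-- Canonical position of a vertex of the cycle `Z/nZ` in `{1, …, n}`. -/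
def cpos {n : ℕ} (v : Fin n) : ℕ := if v.val = 0 then n else v.val

/-- Shift a vertex by `d` steps in the positive direction. -/
def shiftR {n : ℕ} (v : Fin n) (d : ℕ) : Fin n :=
  ⟨(v.val + d) % n, Nat.mod_lt _ (Nat.lt_of_le_of_lt (Nat.zero_le _) v.isLt)⟩

/-- Shift a vertex by `d` steps in the negative direction. -/
def shiftL {n : ℕ} (v : Fin n) (d : ℕ) : Fin n := shiftR v (n - d % n)

/-- Distance (in `[1, n]`) from `v` to the nearest element of `H` in the positive direction. -/
def distR {n : ℕ} (H : Finset (Fin n)) (v : Fin n) : ℕ :=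
  if h : ((Finset.Icc 1 n).filter fun d => shiftR v d ∈ H).Nonempty then
    ((Finset.Icc 1 n).filter fun d => shiftR v d ∈ H).min' h
  else 0

/-- Distance (in `[1, n]`) from `v` to the nearest element of `H` in the negative direction. -/
def distL {n : ℕ} (H : Finset (Fin n)) (v : Fin n) : ℕ :=
  if h : ((Finset.Icc 1 n).filter fun d => shiftL v d ∈ H).Nonempty then
    ((Finset.Icc 1 n).filter fun d => shiftL v d ∈ H).min' h
  else 0

/-- Probability that the ball activated at `v` fills the nearest free hole in the positive
direction, when the current set of free holes is `H`, for the `p`-biased random walk. -/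
noncomputable def rightProb {n : ℕ} (p : ℝ) (H : Finset (Fin n)) (v : Fin n) : ℝ :=
  if p = 1 / 2 then (distL H v : ℝ) / ((distL H v : ℝ) + (distR H v : ℝ))
  else (1 - ((1 - p) / p) ^ distL H v) / (1 - ((1 - p) / p) ^ (distL H v + distR H v))

/-- New set of free holes after the ball at `v` makes its choice
(`true` = fill the nearest free hole in the positive direction). -/
def golfStep {n : ℕ} (H : Finset (Fin n)) (v : Fin n) (choice : Bool) : Finset (Fin n) :=
  if choice then H.erase (shiftR v (distR H v)) else H.erase (shiftL v (distL H v))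

/-- Final set of free holes after activating the listed balls with the listed choices. -/
def golfRun {n : ℕ} : List (Fin n) → List Bool → Finset (Fin n) → Finset (Fin n)
  | v :: vs, c :: cs, H => golfRun vs cs (golfStep H v c)
  | _, _, H => H

/-- Probability of a given sequence of left/right choices. -/
noncomputable def golfWeight {n : ℕ} (p : ℝ) :
    List (Fin n) → List Bool → Finset (Fin n) → ℝ
  | v :: vs, c :: cs, H =>
      (if c then rightProb p H v else 1 - rightProb p H v) * golfWeight p vs cs (golfStep H v c)
  | _, _, _ => 1

/-- Initial data of the golf model: an initial configuration with `nb` balls (listed in their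
activation order, encoded as an embedding `Fin nb ↪ Fin n`) and `nt` holes, the balls and holes
being on distinct vertices.  The initial configuration together with the activation order is
uniform on this set. -/
noncomputable def golfInit (n nb nt : ℕ) : Finset ((Fin nb ↪ Fin n) × Finset (Fin n)) :=
  Finset.univ.filter fun fT => fT.2.card = nt ∧ ∀ i, fT.1 i ∉ fT.2

/-- Expectation of `g B⁰ T⁰ TL` in the golf model on `Z/nZ` with `nb` balls, `nt` holes and
walk parameter `p`, where `B⁰` is the initial set of balls, `T⁰` the initial set of holes and
`TL` the final set of free holes. -/
noncomputable def golfExp (n nb nt : ℕ) (p : ℝ)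
    (g : Finset (Fin n) → Finset (Fin n) → Finset (Fin n) → ℝ) : ℝ :=
  (∑ fT ∈ golfInit n nb nt, ∑ cs : Fin nb → Bool,
      golfWeight p (List.ofFn ⇑fT.1) (List.ofFn cs) fT.2 *
        g (Finset.univ.map fT.1) fT.2 (golfRun (List.ofFn ⇑fT.1) (List.ofFn cs) fT.2)) /
    (golfInit n nb nt).card

/-- `golfProb n nb nt p X` is the probability that the final set of free holes is `X`. -/
noncomputable def golfProb (n nb nt : ℕ) (p : ℝ) (X : Finset (Fin n)) : ℝ :=
  golfExp n nb nt p fun _ _ TL => if TL = X then 1 else 0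

/-- Sorted list of the canonical positions of the elements of `X`. -/
def sortedPos {n : ℕ} (X : Finset (Fin n)) : List ℕ := (X.image cpos).sort (· ≤ ·)

/-- `blockSize X i` is the size `Δ_i X` of the `i`-th block of `X`. -/
def blockSize {n : ℕ} (X : Finset (Fin n)) (i : ℕ) : ℕ :=
  let q := sortedPos X
  let k := q.length
  (q.getD (i % k) 0 + n - q.getD ((i + k - 1) % k) 0 - 1) % n

/-- `blockSet X i` is the `i`-th block `B_i` of `X`: the set of vertices strictly between
`x_i` and `x_{i+1}` in the positive direction. -/
def blockSet {n : ℕ} (X : Finset (Fin n)) (i : ℕ) : Finset (Fin n) :=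
  let q := sortedPos X
  let k := q.length
  let lo := q.getD ((i + k - 1) % k) 0
  let hi := q.getD (i % k) 0
  Finset.univ.filter fun v =>
    if lo < hi then lo < cpos v ∧ cpos v < hi else cpos v < hi ∨ lo < cpos v

/-- Size of the largest block of `X`. -/
def maxBlockSize {n : ℕ} (X : Finset (Fin n)) : ℕ :=
  (Finset.range X.card).sup (blockSize X)

/-- `multinom3 a b c` is the multinomial coefficient `(a+b+c)! / (a! b! c!)`. -/
def multinom3 (a b c : ℕ) : ℕ :=
  (a + b + c).factorial / (a.factorial * b.factorial * c.factorial)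

end Golf

open Golf


namespace Golf

lemma card_golfStep_ge {n : ℕ} (H : Finset (Fin n)) (v : Fin n) (c : Bool) :
    H.card - 1 ≤ (golfStep H v c).card := by
  cases c <;> exact Finset.pred_card_le_card_erase

lemma golfStep_subset {n : ℕ} (H : Finset (Fin n)) (v : Fin n) (c : Bool) :
    golfStep H v c ⊆ H := by
  cases c <;> exact Finset.erase_subset _ _

lemma exists_shiftR_eq {n : ℕ} (v h : Fin n) : ∃ d ∈ Finset.Icc 1 n, shiftR v d = h := by
  by_cases hvh : v.val < h.val
  · refine ⟨h.val - v.val, by simp; omega, ?_⟩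
    ext
    simp only [shiftR]
    rw [Nat.add_sub_cancel' hvh.le, Nat.mod_eq_of_lt h.isLt]
  · refine ⟨n + h.val - v.val, by simp; omega, ?_⟩
    ext
    simp only [shiftR]
    rw [show v.val + (n + h.val - v.val) = h.val + n by omega, Nat.add_mod_right,
      Nat.mod_eq_of_lt h.isLt]

lemma exists_shiftL_eq {n : ℕ} (v h : Fin n) : ∃ d ∈ Finset.Icc 1 n, shiftL v d = h := by
  obtain ⟨d, hd, rfl⟩ := exists_shiftR_eq v h
  rw [Finset.mem_Icc] at hd
  rcases hd.2.eq_or_lt with rfl | hlt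
  · exact ⟨d, by simp; omega, by simp [shiftL]⟩
  · refine ⟨n - d, by simp; omega, ?_⟩
    rw [shiftL, Nat.mod_eq_of_lt (by omega), Nat.sub_sub_self hd.2]

lemma distR_mono {n : ℕ} {H H' : Finset (Fin n)} (hH : H ⊆ H') (hne : H.Nonempty) (v : Fin n) :
    1 ≤ distR H' v ∧ distR H' v ≤ distR H v ∧
      (shiftR v (distR H' v) ∈ H → distR H v = distR H' v) := by
  obtain ⟨h, hh⟩ := hne
  obtain ⟨d, hd, hdh⟩ := exists_shiftR_eq v h
  have h1 : ((Finset.Icc 1 n).filter fun d => shiftR v d ∈ H).Nonempty :=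
    ⟨d, by simp only [Finset.mem_filter]; exact ⟨hd, hdh ▸ hh⟩⟩
  have hsub : ((Finset.Icc 1 n).filter fun d => shiftR v d ∈ H) ⊆
      ((Finset.Icc 1 n).filter fun d => shiftR v d ∈ H') :=
    Finset.monotone_filter_right _ fun _ _ h => hH h
  have h2 := h1.mono hsub
  rw [distR, distR, dif_pos h1, dif_pos h2]
  have hm := Finset.min'_mem _ h2
  have hle := Finset.min'_subset h1 hsub
  rw [Finset.mem_filter, Finset.mem_Icc] at hm
  refine ⟨hm.1.1, hle, fun hin => le_antisymm (Finset.min'_le _ _ ?_) hle⟩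
  rw [Finset.mem_filter, Finset.mem_Icc]
  exact ⟨hm.1, hin⟩

lemma distL_mono {n : ℕ} {H H' : Finset (Fin n)} (hH : H ⊆ H') (hne : H.Nonempty) (v : Fin n) :
    1 ≤ distL H' v ∧ distL H' v ≤ distL H v ∧
      (shiftL v (distL H' v) ∈ H → distL H v = distL H' v) := by
  obtain ⟨h, hh⟩ := hne
  obtain ⟨d, hd, hdh⟩ := exists_shiftL_eq v h
  have h1 : ((Finset.Icc 1 n).filter fun d => shiftL v d ∈ H).Nonempty :=
    ⟨d, by simp only [Finset.mem_filter]; exact ⟨hd, hdh ▸ hh⟩⟩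
  have hsub : ((Finset.Icc 1 n).filter fun d => shiftL v d ∈ H) ⊆
      ((Finset.Icc 1 n).filter fun d => shiftL v d ∈ H') :=
    Finset.monotone_filter_right _ fun _ _ h => hH h
  have h2 := h1.mono hsub
  rw [distL, distL, dif_pos h1, dif_pos h2]
  have hm := Finset.min'_mem _ h2
  have hle := Finset.min'_subset h1 hsub
  rw [Finset.mem_filter, Finset.mem_Icc] at hm
  refine ⟨hm.1.1, hle, fun hin => le_antisymm (Finset.min'_le _ _ ?_) hle⟩
  rw [Finset.mem_filter, Finset.mem_Icc]
  exact ⟨hm.1, hin⟩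

/-- Gambler's ruin weight: the sum `1 + r + ⋯ + r ^ (k - 1)`. -/
noncomputable def ruinSum (r : ℝ) (k : ℕ) : ℝ := ∑ i ∈ Finset.range k, r ^ i

lemma ruinSum_nonneg {r : ℝ} (hr : 0 < r) (k : ℕ) : 0 ≤ ruinSum r k :=
  Finset.sum_nonneg fun _ _ => by positivity

lemma ruinSum_pos {r : ℝ} (hr : 0 < r) {k : ℕ} (hk : 1 ≤ k) : 0 < ruinSum r k :=
  Finset.sum_pos (fun _ _ => by positivity) ⟨0, by simp; omega⟩

lemma ruinSum_add (r : ℝ) (a c : ℕ) : ruinSum r (a + c) = ruinSum r a + r ^ a * ruinSum r c := by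
  simp only [ruinSum, Finset.sum_range_add, Finset.mul_sum, pow_add]

lemma ruinSum_mono {r : ℝ} (hr : 0 < r) {a b : ℕ} (hab : a ≤ b) : ruinSum r a ≤ ruinSum r b := by
  obtain ⟨k, rfl⟩ := Nat.exists_eq_add_of_le hab
  rw [ruinSum_add]
  have := ruinSum_nonneg hr k
  have : 0 ≤ r ^ a * ruinSum r k := by positivity
  linarith

lemma ruinSum_div_le_left {r : ℝ} (hr : 0 < r) {a b c : ℕ} (ha : 1 ≤ a) (hab : a ≤ b) :
    ruinSum r a / ruinSum r (a + c) ≤ ruinSum r b / ruinSum r (b + c) := by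
  rw [div_le_div_iff₀ (ruinSum_pos hr (by omega)) (ruinSum_pos hr (by omega))]
  obtain ⟨k, rfl⟩ := Nat.exists_eq_add_of_le hab
  have h1 : r ^ k * ruinSum r a ≤ ruinSum r (a + k) := by
    rw [add_comm a k, ruinSum_add]
    linarith [ruinSum_nonneg hr k]
  have hc : 0 ≤ r ^ a * ruinSum r c := by
    have := ruinSum_nonneg hr c
    positivity
  rw [ruinSum_add r (a + k) c, ruinSum_add r a c, pow_add]
  nlinarith [mul_le_mul_of_nonneg_left h1 hc]

lemma ruinSum_div_le_right {r : ℝ} (hr : 0 < r) {a b c : ℕ} (ha : 1 ≤ a) (hbc : b ≤ c) :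
    ruinSum r a / ruinSum r (a + c) ≤ ruinSum r a / ruinSum r (a + b) :=
  div_le_div_of_nonneg_left (ruinSum_nonneg hr a) (ruinSum_pos hr (by omega))
    (ruinSum_mono hr (by omega))

lemma rightProb_eq {n : ℕ} {p : ℝ} (hp0 : 0 < p) (H : Finset (Fin n)) (v : Fin n) :
    rightProb p H v =
      ruinSum ((1 - p) / p) (distL H v) / ruinSum ((1 - p) / p) (distL H v + distR H v) := by
  rw [rightProb]
  split_ifs with h
  · subst h
    rw [show (1 - 1 / 2 : ℝ) / (1 / 2) = 1 by norm_num]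
    simp [ruinSum]
  · have hr : (1 - p) / p ≠ 1 := by
      rw [Ne, div_eq_one_iff_eq hp0.ne']
      intro h'
      exact h (by linarith)
    rw [ruinSum, ruinSum, geom_sum_eq hr, geom_sum_eq hr,
      div_div_div_cancel_right₀ (sub_ne_zero.2 hr), ← neg_div_neg_eq, neg_sub, neg_sub]

lemma rightProb_mem_Icc {n : ℕ} {p : ℝ} (hp0 : 0 < p) (hp1 : p < 1) (H : Finset (Fin n))
    (v : Fin n) : 0 ≤ rightProb p H v ∧ rightProb p H v ≤ 1 := by
  have hr : 0 < (1 - p) / p := div_pos (by linarith) hp0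
  rw [rightProb_eq hp0]
  exact ⟨div_nonneg (ruinSum_nonneg hr _) (ruinSum_nonneg hr _),
    div_le_one_of_le₀ (ruinSum_mono hr (by omega)) (ruinSum_nonneg hr _)⟩

/-- Expectation of `g` of the final set of free holes, given the balls in activation order and
the initial set of holes. -/
noncomputable def runExp {n : ℕ} (p : ℝ) (g : Finset (Fin n) → ℝ) :
    List (Fin n) → Finset (Fin n) → ℝ
  | [], H => g H
  | v :: vs, H => rightProb p H v * runExp p g vs (golfStep H v true) +
      (1 - rightProb p H v) * runExp p g vs (golfStep H v false)

lemma sum_golfWeight_mul {n : ℕ} (p : ℝ) (g : Finset (Fin n) → ℝ) {m : ℕ} (f : Fin m → Fin n)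
    (H : Finset (Fin n)) :
    ∑ cs : Fin m → Bool, golfWeight p (List.ofFn f) (List.ofFn cs) H *
      g (golfRun (List.ofFn f) (List.ofFn cs) H) = runExp p g (List.ofFn f) H := by
  induction m generalizing H with
  | zero => simp [golfWeight, golfRun, runExp]
  | succ m ih =>
    rw [← (Fin.consEquiv fun _ : Fin (m + 1) => Bool).sum_comp, Fintype.sum_prod_type]
    simp only [Fin.consEquiv_apply, List.ofFn_succ, Fin.cons_zero, Fin.cons_succ, golfWeight,
      golfRun, runExp, mul_assoc, ← Finset.mul_sum, Fintype.sum_bool, if_true, ih]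
    simp

lemma runExp_antitone {n : ℕ} {p : ℝ} (hp0 : 0 < p) (hp1 : p < 1) {g : Finset (Fin n) → ℝ}
    (hg : ∀ X Y : Finset (Fin n), X.Nonempty → X ⊆ Y → g Y ≤ g X) (vs : List (Fin n))
    {H H' : Finset (Fin n)} (hH : H ⊆ H') (hlen : vs.length < H.card) :
    runExp p g vs H' ≤ runExp p g vs H := by
  induction vs generalizing H H' with
  | nil => exact hg _ _ (Finset.card_pos.1 hlen) hH
  | cons v vs ih =>
    have hne : H.Nonempty := Finset.card_pos.1 (by omega)
    have hlen' : vs.length + 1 < H.card := hlen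
    have key : ∀ (c : Bool) (Y : Finset (Fin n)), golfStep H v c ⊆ Y →
        runExp p g vs Y ≤ runExp p g vs (golfStep H v c) := fun c Y hY =>
      ih hY (by have := card_golfStep_ge H v c; omega)
    have hr : 0 < (1 - p) / p := div_pos (by linarith) hp0
    obtain ⟨hR1, hR2, hR3⟩ := distR_mono hH hne v
    obtain ⟨hL1, hL2, hL3⟩ := distL_mono hH hne v
    obtain ⟨hq0, hq1⟩ := rightProb_mem_Icc hp0 hp1 H v
    obtain ⟨hq0', hq1'⟩ := rightProb_mem_Icc hp0 hp1 H' v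
    have hsubR (hin : shiftR v (distR H' v) ∈ H) : golfStep H v true ⊆ golfStep H' v true := by
      simp only [golfStep, if_true, hR3 hin]
      exact Finset.erase_subset_erase _ hH
    have hsubL (hin : shiftL v (distL H' v) ∈ H) : golfStep H v false ⊆ golfStep H' v false := by
      simp only [golfStep, Bool.false_eq_true, if_false, hL3 hin]
      exact Finset.erase_subset_erase _ hH
    have hoffR (hin : shiftR v (distR H' v) ∉ H) (c : Bool) :
        golfStep H v c ⊆ golfStep H' v true :=
      (golfStep_subset H v c).trans (Finset.subset_erase.2 ⟨hH, hin⟩)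
    have hoffL (hin : shiftL v (distL H' v) ∉ H) (c : Bool) :
        golfStep H v c ⊆ golfStep H' v false :=
      (golfStep_subset H v c).trans (Finset.subset_erase.2 ⟨hH, hin⟩)
    have conv {q x y z : ℝ} (h0 : 0 ≤ q) (h1 : q ≤ 1) (hx : z ≤ x) (hy : z ≤ y) :
        z ≤ q * x + (1 - q) * y := by nlinarith
    simp only [runExp]
    by_cases hinR : shiftR v (distR H' v) ∈ H <;> by_cases hinL : shiftL v (distL H' v) ∈ H
    · have heq : rightProb p H' v = rightProb p H v := by
        rw [rightProb_eq hp0, rightProb_eq hp0, hR3 hinR, hL3 hinL]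
      rw [heq]
      exact add_le_add (mul_le_mul_of_nonneg_left (key _ _ (hsubR hinR)) hq0)
        (mul_le_mul_of_nonneg_left (key _ _ (hsubL hinL)) (by linarith))
    · have hle : rightProb p H' v ≤ rightProb p H v := by
        rw [rightProb_eq hp0, rightProb_eq hp0, hR3 hinR]
        exact ruinSum_div_le_left hr hL1 hL2
      have h1 := key _ _ (hsubR hinR)
      have h2 := key _ _ (hoffL hinL true)
      have h3 := key _ _ (hoffL hinL false)
      nlinarith
    · have hle : rightProb p H v ≤ rightProb p H' v := by
        rw [rightProb_eq hp0, rightProb_eq hp0, hL3 hinL]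
        exact ruinSum_div_le_right hr hL1 hR2
      have h1 := key _ _ (hsubL hinL)
      have h2 := key _ _ (hoffR hinR true)
      have h3 := key _ _ (hoffR hinR false)
      nlinarith
    · have h1 := conv hq0 hq1 (key _ _ (hoffR hinR true)) (key _ _ (hoffR hinR false))
      have h2 := conv hq0 hq1 (key _ _ (hoffL hinL true)) (key _ _ (hoffL hinL false))
      nlinarith

lemma runExp_insert_le_cons {n : ℕ} {p : ℝ} (hp0 : 0 < p) (hp1 : p < 1) {g : Finset (Fin n) → ℝ}
    (hg : ∀ X Y : Finset (Fin n), X.Nonempty → X ⊆ Y → g Y ≤ g X) (v : Fin n)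
    (vs : List (Fin n)) {H : Finset (Fin n)} (hlen : vs.length + 1 < H.card) :
    runExp p g vs (insert v H) ≤ runExp p g (v :: vs) H := by
  have key (c : Bool) : runExp p g vs (insert v H) ≤ runExp p g vs (golfStep H v c) :=
    runExp_antitone hp0 hp1 hg vs ((golfStep_subset H v c).trans (Finset.subset_insert v H))
      (by have := card_golfStep_ge H v c; omega)
  obtain ⟨hq0, hq1⟩ := rightProb_mem_Icc hp0 hp1 H v
  have h1 := key true
  have h2 := key false
  simp only [runExp]
  nlinarith

lemma sum_golfInit_succ {n m s : ℕ} (Φ : (Fin m → Fin n) → Finset (Fin n) → ℝ) :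
    ∑ fT ∈ golfInit n (m + 1) s, Φ (fun i => fT.1 i.succ) (insert (fT.1 0) fT.2) =
      (s + 1 : ℝ) * ∑ fT ∈ golfInit n m (s + 1), Φ fT.1 fT.2 := by
  have hcard : (s + 1 : ℝ) * ∑ fT ∈ golfInit n m (s + 1), Φ fT.1 fT.2 =
      ∑ fT ∈ golfInit n m (s + 1), ∑ _x ∈ fT.2, Φ fT.1 fT.2 := by
    rw [Finset.mul_sum]
    refine Finset.sum_congr rfl fun fT hfT => ?_
    rw [golfInit, Finset.mem_filter] at hfT
    rw [Finset.sum_const, hfT.2.1, nsmul_eq_mul]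
    push_cast
    rfl
  rw [hcard, Finset.sum_sigma']
  refine Finset.sum_bij
    (fun fT _ => ⟨((Fin.succEmb m).trans fT.1, insert (fT.1 0) fT.2), fT.1 0⟩)
    ?_ ?_ ?_ ?_
  · rintro ⟨f, T⟩ h
    simp only [golfInit, Finset.mem_filter, Finset.mem_univ, true_and] at h
    simp only [golfInit, Finset.mem_sigma, Finset.mem_filter, Finset.mem_univ, true_and,
      Finset.mem_insert_self, and_true]
    refine ⟨by rw [Finset.card_insert_of_notMem (h.2 0), h.1], fun i => ?_⟩
    simp only [Finset.mem_insert, not_or]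
    refine ⟨fun h' => ?_, h.2 _⟩
    exact Fin.succ_ne_zero i (f.injective h')
  · rintro ⟨f, T⟩ h ⟨f', T'⟩ h' heq
    simp only [golfInit, Finset.mem_filter, Finset.mem_univ, true_and] at h h'
    simp only [Sigma.mk.injEq, Prod.mk.injEq, heq_eq_eq] at heq
    obtain ⟨⟨h1, h2⟩, h3⟩ := heq
    refine Prod.ext ?_ ?_
    · ext i : 1
      refine Fin.cases h3 (fun j => ?_) i
      exact DFunLike.congr_fun h1 j
    · have := congrArg (fun S => S.erase (f 0)) h2
      simp only [Finset.erase_insert (h.2 0)] at this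
      rw [h3, Finset.erase_insert (h'.2 0)] at this
      exact this
  · rintro ⟨⟨f, T⟩, x⟩ h
    simp only [golfInit, Finset.mem_sigma, Finset.mem_filter, Finset.mem_univ, true_and] at h
    obtain ⟨⟨hT, hf⟩, hx⟩ := h
    have hxf : x ∉ Set.range f := by
      rintro ⟨i, rfl⟩
      exact hf i hx
    refine ⟨(Fin.Embedding.cons f hxf, T.erase x), ?_, ?_⟩
    · simp only [golfInit, Finset.mem_filter, Finset.mem_univ, true_and]
      refine ⟨by rw [Finset.card_erase_of_mem hx, hT]; rfl, fun i => ?_⟩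
      refine Fin.cases ?_ (fun j => ?_) i
      · simp
      · simp [Fin.Embedding.cons, hf j]
    · have hcons0 : Fin.Embedding.cons f hxf 0 = x := by simp [Fin.Embedding.cons]
      have : (Fin.succEmb m).trans (Fin.Embedding.cons f hxf) = f := by
        ext i : 1
        simp [Fin.Embedding.cons]
      simp [this, Finset.insert_erase hx, hcons0]
  · rintro ⟨f, T⟩ h
    rfl

lemma card_golfInit_succ (n m s : ℕ) :
    ((golfInit n (m + 1) s).card : ℝ) = (s + 1) * (golfInit n m (s + 1)).card := by
  have := sum_golfInit_succ (n := n) (m := m) (s := s) fun _ _ => 1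
  simpa using this

lemma golfExp_eq (n nb nt : ℕ) (p : ℝ) (g : Finset (Fin n) → ℝ) :
    (golfExp n nb nt p fun _ _ TL => g TL) =
      (∑ fT ∈ golfInit n nb nt, runExp p g (List.ofFn ⇑fT.1) fT.2) / (golfInit n nb nt).card := by
  simp only [golfExp, sum_golfWeight_mul]

lemma golfExp_le_golfExp_succ {n m s : ℕ} {p : ℝ} (hp0 : 0 < p) (hp1 : p < 1)
    {g : Finset (Fin n) → ℝ} (hg : ∀ X Y : Finset (Fin n), X.Nonempty → X ⊆ Y → g Y ≤ g X)
    (hms : m + 1 < s) :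
    (golfExp n m (s + 1) p fun _ _ TL => g TL) ≤ golfExp n (m + 1) s p fun _ _ TL => g TL := by
  rw [golfExp_eq, golfExp_eq, card_golfInit_succ,
    ← mul_div_mul_left _ _ (show (s + 1 : ℝ) ≠ 0 by positivity),
    ← sum_golfInit_succ fun f T => runExp p g (List.ofFn f) T]
  refine div_le_div_of_nonneg_right (Finset.sum_le_sum fun fT hfT => ?_) (by positivity)
  rw [golfInit, Finset.mem_filter] at hfT
  rw [List.ofFn_succ (f := ⇑fT.1)]
  exact runExp_insert_le_cons hp0 hp1 hg _ _ (by rw [List.length_ofFn, hfT.2.1]; exact hms)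

lemma cpos_bounds {n : ℕ} (v : Fin n) : 1 ≤ cpos v ∧ cpos v ≤ n := by
  have := v.isLt
  rw [cpos]
  split_ifs <;> omega

lemma cpos_mod {n : ℕ} (v : Fin n) : cpos v % n = v.val := by
  rw [cpos]
  split_ifs with h
  · rw [Nat.mod_self, h]
  · exact Nat.mod_eq_of_lt v.isLt

lemma cpos_injective {n : ℕ} : Function.Injective (cpos (n := n)) := fun v w h => by
  ext
  rw [← cpos_mod v, ← cpos_mod w, h]

lemma shiftR_eq_of_cpos {n : ℕ} {v x : Fin n} {d : ℕ}
    (h : cpos x = cpos v + d ∨ cpos x + n = cpos v + d) : shiftR v d = x := by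
  ext
  have hv : (v.val + d) % n = (cpos v + d) % n := by
    rw [← cpos_mod v, Nat.mod_add_mod]
  refine hv.trans ?_
  rcases h with h | h
  · rw [← h, cpos_mod]
  · rw [← h, Nat.add_mod_right, cpos_mod]

lemma exists_cpos_eq {n c : ℕ} (h1 : 1 ≤ c) (h2 : c ≤ n) : ∃ v : Fin n, cpos v = c := by
  rcases h2.eq_or_lt with rfl | h
  · exact ⟨⟨0, h1⟩, if_pos rfl⟩
  · exact ⟨⟨c, h⟩, if_neg (Nat.pos_iff_ne_zero.1 h1)⟩

lemma cpos_shiftR {n : ℕ} (v : Fin n) {d : ℕ} (hd : d ≤ n) :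
    cpos (shiftR v d) = cpos v + d ∨ cpos (shiftR v d) + n = cpos v + d := by
  have hb := cpos_bounds v
  by_cases hle : cpos v + d ≤ n
  · obtain ⟨x, hx⟩ := exists_cpos_eq (by omega) hle
    rw [shiftR_eq_of_cpos (.inl hx)]
    exact .inl hx
  · obtain ⟨x, hx⟩ := exists_cpos_eq (n := n) (c := cpos v + d - n) (by omega) (by omega)
    have hx' : cpos x + n = cpos v + d := by omega
    rw [shiftR_eq_of_cpos (.inr hx')]
    exact .inr hx'

lemma length_sortedPos {n : ℕ} (X : Finset (Fin n)) : (sortedPos X).length = X.card := by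
  rw [sortedPos, Finset.length_sort, Finset.card_image_of_injective _ cpos_injective]

lemma mem_sortedPos {n : ℕ} {X : Finset (Fin n)} {c : ℕ} :
    c ∈ sortedPos X ↔ ∃ x ∈ X, cpos x = c := by
  simp [sortedPos]

lemma getD_sortedPos_mem {n : ℕ} {X : Finset (Fin n)} {i : ℕ} (hi : i < X.card) :
    ∃ x ∈ X, cpos x = (sortedPos X).getD i 0 := by
  rw [← length_sortedPos] at hi
  rw [List.getD_eq_getElem _ _ hi]
  exact mem_sortedPos.1 (List.getElem_mem hi)

lemma exists_getD_sortedPos {n : ℕ} {X : Finset (Fin n)} {x : Fin n} (hx : x ∈ X) :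
    ∃ i < X.card, (sortedPos X).getD i 0 = cpos x := by
  obtain ⟨i, hi, h⟩ := List.getElem_of_mem (mem_sortedPos.2 ⟨x, hx, rfl⟩)
  exact ⟨i, length_sortedPos X ▸ hi, by rw [List.getD_eq_getElem _ _ hi, h]⟩

lemma getD_sortedPos_lt {n : ℕ} {X : Finset (Fin n)} {i j : ℕ} (hij : i < j) (hj : j < X.card) :
    (sortedPos X).getD i 0 < (sortedPos X).getD j 0 := by
  rw [← length_sortedPos] at hj
  rw [List.getD_eq_getElem _ _ hj, List.getD_eq_getElem _ _ (hij.trans hj)]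
  exact (Finset.sortedLT_sort _).strictMono_get (a := ⟨i, hij.trans hj⟩) (b := ⟨j, hj⟩) hij

lemma blockSize_zero {n : ℕ} {X : Finset (Fin n)} (hX : X.Nonempty) :
    blockSize X 0 = (sortedPos X).getD 0 0 + n - (sortedPos X).getD (X.card - 1) 0 - 1 := by
  have hk := Finset.card_pos.2 hX
  obtain ⟨x, hx, hx0⟩ := getD_sortedPos_mem (X := X) (i := 0) hk
  obtain ⟨y, hy, hy0⟩ := getD_sortedPos_mem (X := X) (i := X.card - 1) (by omega)
  have hbx := cpos_bounds x
  have hby := cpos_bounds y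
  have hle : (sortedPos X).getD 0 0 ≤ (sortedPos X).getD (X.card - 1) 0 := by
    rcases Nat.eq_zero_or_pos (X.card - 1) with h | h
    · rw [h]
    · exact (getD_sortedPos_lt h (by omega)).le
  simp only [blockSize, length_sortedPos, Nat.zero_mod, Nat.zero_add]
  rw [Nat.mod_eq_of_lt (show X.card - 1 < X.card by omega), Nat.mod_eq_of_lt (by omega)]

lemma blockSize_succ {n : ℕ} {X : Finset (Fin n)} {i : ℕ} (hi : i + 1 < X.card) :
    blockSize X (i + 1) = (sortedPos X).getD (i + 1) 0 - (sortedPos X).getD i 0 - 1 := by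
  obtain ⟨x, hx, hx0⟩ := getD_sortedPos_mem (X := X) hi
  have hbx := cpos_bounds x
  have hlt := getD_sortedPos_lt (X := X) (show i < i + 1 by omega) hi
  simp only [blockSize, length_sortedPos]
  rw [Nat.mod_eq_of_lt hi, show i + 1 + X.card - 1 = i + X.card by omega, Nat.add_mod_right,
    Nat.mod_eq_of_lt (show i < X.card by omega),
    show (sortedPos X).getD (i + 1) 0 + n - (sortedPos X).getD i 0 - 1 =
      (sortedPos X).getD (i + 1) 0 - (sortedPos X).getD i 0 - 1 + n by omega,
    Nat.add_mod_right, Nat.mod_eq_of_lt (by omega)]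

lemma exists_run_of_maxBlockSize {n : ℕ} {X : Finset (Fin n)} (hX : X.Nonempty) :
    ∃ v : Fin n, ∀ d, 1 ≤ d → d ≤ maxBlockSize X → shiftR v d ∉ X := by
  have hk := Finset.card_pos.2 hX
  obtain ⟨i, hi, hsup⟩ := Finset.exists_mem_eq_sup (Finset.range X.card)
    (Finset.nonempty_range_iff.2 hk.ne') (blockSize X)
  rw [Finset.mem_range] at hi
  rw [maxBlockSize, hsup]
  rcases i with _ | i
  · rw [blockSize_zero hX]
    obtain ⟨x, hx, hx0⟩ := getD_sortedPos_mem (X := X) (i := 0) hk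
    obtain ⟨y, hy, hy0⟩ := getD_sortedPos_mem (X := X) (i := X.card - 1) (by omega)
    rw [← hx0, ← hy0]
    refine ⟨y, fun d hd1 hd2 hmem => ?_⟩
    obtain ⟨j, hj, hjc⟩ := exists_getD_sortedPos hmem
    have hbx := cpos_bounds x
    have hby := cpos_bounds y
    have hbz := cpos_bounds (shiftR y d)
    have h1 : cpos x ≤ cpos (shiftR y d) := by
      rw [hx0, ← hjc]
      rcases Nat.eq_zero_or_pos j with rfl | h
      · exact le_rfl
      · exact (getD_sortedPos_lt h hj).le
    have h2 : cpos (shiftR y d) ≤ cpos y := by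
      rw [hy0, ← hjc]
      rcases (Nat.le_sub_one_of_lt hj).eq_or_lt with h | h
      · rw [h]
      · exact (getD_sortedPos_lt h (by omega)).le
    have := cpos_shiftR y (d := d) (by omega)
    omega
  · rw [blockSize_succ hi]
    obtain ⟨x, hx, hx0⟩ := getD_sortedPos_mem (X := X) hi
    obtain ⟨y, hy, hy0⟩ := getD_sortedPos_mem (X := X) (i := i) (by omega)
    rw [← hx0, ← hy0]
    refine ⟨y, fun d hd1 hd2 hmem => ?_⟩
    obtain ⟨j, hj, hjc⟩ := exists_getD_sortedPos hmem
    have hbx := cpos_bounds x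
    have hby := cpos_bounds y
    have hbz := cpos_bounds (shiftR y d)
    have := cpos_shiftR y (d := d) (by omega)
    rcases lt_trichotomy j i with h | h | h
    · have := getD_sortedPos_lt h (show i < X.card by omega)
      omega
    · subst h
      omega
    · have : cpos x ≤ cpos (shiftR y d) := by
        rw [hx0, ← hjc]
        rcases (Nat.succ_le_of_lt h).eq_or_lt with h | h
        · rw [← h]
        · exact (getD_sortedPos_lt h hj).le
      omega

lemma le_maxBlockSize_of_run {n : ℕ} {X : Finset (Fin n)} (hX : X.Nonempty) {v : Fin n} {s : ℕ}
    (hs : ∀ d, 1 ≤ d → d ≤ s → shiftR v d ∉ X) : s ≤ maxBlockSize X := by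
  have hk := Finset.card_pos.2 hX
  have hv := cpos_bounds v
  have hoff {x : Fin n} (hx : x ∈ X) {d : ℕ} (hd : 1 ≤ d)
      (h : cpos x = cpos v + d ∨ cpos x + n = cpos v + d) : s < d := by
    by_contra! hds
    exact hs d hd hds (shiftR_eq_of_cpos h ▸ hx)
  have hle {i : ℕ} (hi : i < X.card) : blockSize X i ≤ maxBlockSize X :=
    Finset.le_sup (Finset.mem_range.2 hi)
  obtain ⟨x, hx, hx0⟩ := getD_sortedPos_mem (X := X) (i := 0) hk
  have hbx := cpos_bounds x
  have h0 := hle hk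
  rw [blockSize_zero hX] at h0
  have hlast : (sortedPos X).getD (X.card - 1) 0 ≤ n := by
    obtain ⟨y, hy, hy0⟩ := getD_sortedPos_mem (X := X) (i := X.card - 1) (by omega)
    exact hy0 ▸ (cpos_bounds y).2
  by_cases hvx : cpos v < cpos x
  · have := hoff hx (d := cpos x - cpos v) (by omega) (.inl (by omega))
    omega
  · let j := Nat.findGreatest (fun j => (sortedPos X).getD j 0 ≤ cpos v) (X.card - 1)
    have hj : (sortedPos X).getD j 0 ≤ cpos v :=
      Nat.findGreatest_spec (P := fun j => (sortedPos X).getD j 0 ≤ cpos v) (Nat.zero_le _)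
        (by omega)
    have hjk : j ≤ X.card - 1 := Nat.findGreatest_le _
    rcases hjk.eq_or_lt with h | h
    · rw [h] at hj
      have := hoff hx (d := cpos x + n - cpos v) (by omega) (.inr (by omega))
      omega
    · have hgt : ¬ (sortedPos X).getD (j + 1) 0 ≤ cpos v :=
        Nat.findGreatest_is_greatest (P := fun j => (sortedPos X).getD j 0 ≤ cpos v)
          (Nat.lt_succ_self j) h
      have hj1 := hle (i := j + 1) (by omega)
      rw [blockSize_succ (by omega)] at hj1
      obtain ⟨y, hy, hy0⟩ := getD_sortedPos_mem (X := X) (i := j + 1) (by omega)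
      have := hoff hy (d := cpos y - cpos v) (by omega) (.inl (by omega))
      omega

lemma maxBlockSize_antitone {n : ℕ} {X Y : Finset (Fin n)} (hX : X.Nonempty) (hXY : X ⊆ Y) :
    maxBlockSize Y ≤ maxBlockSize X := by
  obtain ⟨v, hv⟩ := exists_run_of_maxBlockSize (hX.mono hXY)
  exact le_maxBlockSize_of_run hX fun d h1 h2 h => hv d h1 h2 (hXY h)

end Golf

/-- **Stochastic monotonicity of the largest block size in the number of remaining holes**
(Corollary 2.9 of the paper).  For a fixed `n` and `1 ≤ K ≤ K' ≤ n` of the same parity as `n`,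
in the golf model without neutral vertices (`nb = (n-K)/2`, `nt = (n+K)/2`), for every `t ≥ 0`,
`P^{(n,K')}(max_i Δ_i TL ≥ t) ≤ P^{(n,K)}(max_i Δ_i TL ≥ t)`. -/
theorem golf_max_block_monotone (n K K' : ℕ) (hn : 1 ≤ n) (hK1 : 1 ≤ K) (hKK' : K ≤ K')
    (hK'n : K' ≤ n) (hpar : K % 2 = n % 2) (hpar' : K' % 2 = n % 2)
    (p : ℝ) (hp0 : 0 < p) (hp1 : p < 1) (t : ℝ) (ht : 0 ≤ t) :
    (golfExp n ((n - K') / 2) ((n + K') / 2) p fun _ _ TL =>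
        if t ≤ (maxBlockSize TL : ℝ) then 1 else 0) ≤
      (golfExp n ((n - K) / 2) ((n + K) / 2) p fun _ _ TL =>
        if t ≤ (maxBlockSize TL : ℝ) then 1 else 0) := by
  have hg : ∀ X Y : Finset (Fin n), X.Nonempty → X ⊆ Y →
      (if t ≤ (maxBlockSize Y : ℝ) then (1 : ℝ) else 0) ≤
        if t ≤ (maxBlockSize X : ℝ) then 1 else 0 := by
    intro X Y hX hXY
    have hle : (maxBlockSize Y : ℝ) ≤ maxBlockSize X := by
      exact_mod_cast maxBlockSize_antitone hX hXY
    split_ifs with h1 h2 <;> first | exact absurd (h1.trans hle) h2 | norm_num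
  obtain ⟨j, rfl⟩ : ∃ j, K' = K + 2 * j := ⟨(K' - K) / 2, by omega⟩
  induction j with
  | zero => exact le_rfl
  | succ j ih =>
    refine le_trans ?_ (ih (by omega) (by omega) (by omega))
    rw [show (n + (K + 2 * (j + 1))) / 2 = (n + (K + 2 * j)) / 2 + 1 by omega,
      show (n - (K + 2 * j)) / 2 = (n - (K + 2 * (j + 1))) / 2 + 1 by omega]
    exact golfExp_le_golfExp_succ hp0 hp1
      (g := fun TL => if t ≤ (maxBlockSize TL : ℝ) then 1 else 0) hg (by omega)
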